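/- (Case 2.1.1 reduction) Let $n \ge 2$, let $X$ be a metric space, and let $v_1,\dots,v_n$ be pairwise distinct points of $X$, regarded as the vertices of a path $P$ whose edge joining $v_m$ and $v_{m+1}$ has length $\operatorname{dist}(v_m,v_{m+1})$. For $a,b\in\{1,\dots,n\}$ let $d_P(a,b)=\sum_{m=\min(a,b)}^{\max(a,b)-1}\operatorname{dist}(v_m,v_{m+1})$. For $1\le i\le j\le n$ let $G(i,j)$ be $P$ together with an extra edge of length $\operatorname{dist}(v_i,v_j)$ joining $v_i$ and $v_j$; its shortest-path distance is $$d_{G(i,j)}(a,b)=\min\bigl(d_P(a,b),\; d_P(a,i)+\operatorname{dist}(v_i,v_j)+d_P(j,b),\; d_P(a,j)+\operatorname{dist}(v_i,v_j)+d_P(i,b)\bigr).$$ Let $\operatorname{ecc}(i,j,c)=\max_{1\le k\le n} d_{G(i,j)}(c,k)$, $\operatorname{rad}(i,j)=\min_{1\le c\le n}\operatorname{ecc}(i,j,c)$ and $r^*=\min_{1\le i\le j\le n}\operatorname{rad}(i,j)$. Call $v_c$ a center of $G(i,j)$ if $\operatorname{ecc}(i,j,c)=\operatorname{rad}(i,j)$,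 and call $(i,j)$ an optimal solution if $\operatorname{rad}(i,j)=r^*$. Let $1\le i<c<j\le n$ and $r=\operatorname{ecc}(i,j,c)$. Suppose $d_{G(i,j)}(c,1)=r$ and $r=d_P(c,j)+\operatorname{dist}(v_i,v_j)+d_P(1,i)$ (that is, $v_1$ is a farthest vertex from $v_c$ in $G(i,j)$, and some shortest path from $v_c$ to $v_1$ in $G(i,j)$ passes through the added edge). Then $d_{G(i,c)}(c,k)\le r$ for every $k$ with $1\le k\le n$; consequently $\operatorname{ecc}(i,c,c)\le r$. If additionally $(i,j)$ is an optimal solution and $v_c$ is a center of $G(i,j)$, then $(i,c)$ is an optimal solution and $v_c$ is a center of $G(i,c)$. -/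

import Mathlib

/-- Path distance along `P` between vertices `a` and `b`. -/
noncomputable def dP {X : Type*} [MetricSpace X] (v : ℕ → X) (a b : ℕ) : ℝ :=
  ∑ m ∈ Finset.Ico (min a b) (max a b), dist (v m) (v (m + 1))

/-- Shortest-path distance in the augmented graph `G(i,j)`: a shortest path either stays on `P`
or uses the extra edge exactly once, in one of its two directions. -/
noncomputable def dG {X : Type*} [MetricSpace X] (v : ℕ → X) (i j a b : ℕ) : ℝ :=
  min (dP v a b)
    (min (dP v a i + dist (v i) (v j) + dP v j b)
         (dP v a j + dist (v i) (v j) + dP v i b))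

/-- Eccentricity of vertex `c` in `G(i,j)`: `max_{1 ≤ k ≤ n} dG(c,k)`. -/
noncomputable def ecc {X : Type*} [MetricSpace X] (v : ℕ → X) (n i j c : ℕ) : ℝ :=
  sSup ((fun k => dG v i j c k) '' Set.Icc 1 n)

/-- Radius of `G(i,j)`: `min_{1 ≤ c ≤ n} ecc(i,j,c)`. -/
noncomputable def rad {X : Type*} [MetricSpace X] (v : ℕ → X) (n i j : ℕ) : ℝ :=
  sInf ((fun c => ecc v n i j c) '' Set.Icc 1 n)

/-- Optimal radius: `min_{1 ≤ i ≤ j ≤ n} rad(i,j)`. -/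
noncomputable def rstar {X : Type*} [MetricSpace X] (v : ℕ → X) (n : ℕ) : ℝ :=
  sInf {x | ∃ i j : ℕ, 1 ≤ i ∧ i ≤ j ∧ j ≤ n ∧ x = rad v n i j}

section PathDistance

variable {X : Type*} [MetricSpace X] (v : ℕ → X)

theorem dP_comm (a b : ℕ) : dP v a b = dP v b a := by
  simp only [dP, min_comm, max_comm]

theorem dP_nonneg (a b : ℕ) : 0 ≤ dP v a b :=
  Finset.sum_nonneg fun _ _ => dist_nonneg

theorem dP_add {a b c : ℕ} (hab : a ≤ b) (hbc : b ≤ c) : dP v a b + dP v b c = dP v a c := by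
  simp only [dP, min_eq_left hab, max_eq_right hab, min_eq_left hbc, max_eq_right hbc,
    min_eq_left (hab.trans hbc), max_eq_right (hab.trans hbc)]
  exact Finset.sum_Ico_consecutive _ hab hbc

theorem dist_le_dP {a b : ℕ} (hab : a ≤ b) : dist (v a) (v b) ≤ dP v a b := by
  simp only [dP, min_eq_left hab, max_eq_right hab]
  exact dist_le_Ico_sum_dist v hab

theorem dG_nonneg (i j a b : ℕ) : 0 ≤ dG v i j a b :=
  le_min (dP_nonneg v a b) (le_min
    (add_nonneg (add_nonneg (dP_nonneg v a i) dist_nonneg) (dP_nonneg v j b))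
    (add_nonneg (add_nonneg (dP_nonneg v a j) dist_nonneg) (dP_nonneg v i b)))

theorem dG_le_dP (i j a b : ℕ) : dG v i j a b ≤ dP v a b :=
  min_le_left _ _

theorem dG_self_right_le (i c k : ℕ) : dG v i c c k ≤ dist (v i) (v c) + dP v i k := by
  have h : dP v c c = 0 := by simp [dP]
  calc dG v i c c k ≤ dP v c c + dist (v i) (v c) + dP v i k :=
        (min_le_right _ _).trans (min_le_right _ _)
    _ = dist (v i) (v c) + dP v i k := by rw [h, zero_add]

theorem dG_le_ecc (n i j c : ℕ) {k : ℕ} (hk : k ∈ Set.Icc 1 n) : dG v i j c k ≤ ecc v n i j c :=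
  le_csSup ((Set.finite_Icc 1 n).image _).bddAbove (Set.mem_image_of_mem _ hk)

theorem ecc_le {n i j c : ℕ} {r : ℝ} (hn : 1 ≤ n)
    (h : ∀ k, 1 ≤ k → k ≤ n → dG v i j c k ≤ r) : ecc v n i j c ≤ r := by
  refine csSup_le ((Set.nonempty_Icc.2 hn).image _) ?_
  rintro _ ⟨k, hk, rfl⟩
  exact h k hk.1 hk.2

theorem ecc_nonneg (n i j c : ℕ) : 0 ≤ ecc v n i j c := by
  refine Real.sSup_nonneg ?_
  rintro _ ⟨k, -, rfl⟩
  exact dG_nonneg v i j c k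

theorem rad_le_ecc (n i j : ℕ) {c : ℕ} (hc : c ∈ Set.Icc 1 n) : rad v n i j ≤ ecc v n i j c :=
  csInf_le ((Set.finite_Icc 1 n).image _).bddBelow (Set.mem_image_of_mem _ hc)

theorem rad_nonneg (n i j : ℕ) : 0 ≤ rad v n i j := by
  refine Real.sInf_nonneg ?_
  rintro _ ⟨c, -, rfl⟩
  exact ecc_nonneg v n i j c

theorem rstar_le_rad {n i j : ℕ} (hi : 1 ≤ i) (hij : i ≤ j) (hj : j ≤ n) :
    rstar v n ≤ rad v n i j := by
  refine csInf_le ⟨0, ?_⟩ ⟨i, j, hi, hij, hj, rfl⟩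
  rintro _ ⟨a, b, -, -, -, rfl⟩
  exact rad_nonneg v n a b

/-- If the detour from `c` through `j` and the extra edge to `i` is no longer than the path
from `c` back to `i`, then moving the end `j` of the extra edge to `c` only decreases the
distances from `c` to the vertices from `i` on, except possibly for those strictly between
`c` and `j`, where the path distance is at most `dP v c j` anyway. -/
theorem dG_move_endpoint_le {i c j k : ℕ} (hic : i ≤ c) (hcj : c ≤ j) (hik : i ≤ k)
    (hshort : dP v c j + dist (v i) (v j) ≤ dP v i c) :
    dG v i c c k ≤ max (dG v i j c k) (dP v c j) := by
  have hij := dist_nonneg (x := v i) (y := v j)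
  have htri : dist (v i) (v c) ≤ dist (v i) (v j) + dP v c j := by
    have h1 := dist_triangle (v i) (v j) (v c)
    have h2 := dist_le_dP v hcj
    rw [dist_comm (v j) (v c)] at h1
    linarith
  have hedge := dG_self_right_le v i c k
  have hpath := dG_le_dP v i c c k
  rcases le_total k j with hkj | hjk
  · rcases le_total k c with hkc | hck
    · refine le_max_of_le_left (le_min hpath (le_min ?_ ?_))
      · have h1 := dP_add v hik hkc
        have h2 := dP_nonneg v i k
        have h3 := dP_nonneg v j k
        rw [dP_comm v c k] at hpath
        rw [dP_comm v c i]
        linarith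
      · linarith
    · refine le_max_of_le_right ?_
      have h1 := dP_add v hck hkj
      have h2 := dP_nonneg v k j
      linarith
  · have h1 := dP_add v hcj hjk
    refine le_max_of_le_left (le_min hpath (le_min ?_ ?_))
    · rw [dP_comm v c i]
      linarith
    · have h2 := dP_add v (hic.trans hcj) hjk
      have h3 := dP_nonneg v i j
      linarith

end PathDistance

theorem stmt_10 {X : Type*} [MetricSpace X] (n : ℕ) (hn : 2 ≤ n) (v : ℕ → X)
    (hv : Set.InjOn v (Set.Icc 1 n))
    (i c j : ℕ) (hi : 1 ≤ i) (hic : i < c) (hcj : c < j) (hjn : j ≤ n)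
    (r : ℝ) (hr : r = ecc v n i j c)
    (hfar : dG v i j c 1 = r)
    (hpath : r = dP v c j + dist (v i) (v j) + dP v 1 i) :
    (∀ k : ℕ, 1 ≤ k → k ≤ n → dG v i c c k ≤ r) ∧
    ecc v n i c c ≤ r ∧
    (rad v n i j = rstar v n → ecc v n i j c = rad v n i j →
      rad v n i c = rstar v n ∧ ecc v n i c c = rad v n i c) := by
  have hle : ∀ k : ℕ, 1 ≤ k → k ≤ n → dG v i c c k ≤ r := by
    intro k hk hkn
    have hij := dist_nonneg (x := v i) (y := v j)
    have h1i := dP_nonneg v 1 i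
    rcases le_total k i with hki | hik
    · have h1 := dG_self_right_le v i c k
      have h2 := dP_add v hk hki
      have h3 := dP_nonneg v 1 k
      have h4 := dist_triangle (v i) (v j) (v c)
      have h5 := dist_le_dP v hcj.le
      rw [dist_comm (v j) (v c)] at h4
      rw [dP_comm v i k] at h1
      linarith
    · have hshort : dP v c j + dist (v i) (v j) ≤ dP v i c := by
        have h1 := dG_le_dP v i j c 1
        have h2 := dP_add v hi hic.le
        rw [dP_comm v c 1] at h1
        linarith
      refine (dG_move_endpoint_le v hic.le hcj.le hik hshort).trans (max_le ?_ ?_)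
      · exact hr ▸ dG_le_ecc v n i j c ⟨hk, hkn⟩
      · linarith
  have hecc : ecc v n i c c ≤ r := ecc_le v (by omega) hle
  refine ⟨hle, hecc, fun hopt hcenter => ?_⟩
  have h1 := rstar_le_rad v hi hic.le (hcj.le.trans hjn)
  have h2 := rad_le_ecc v n i c (c := c) ⟨by omega, by omega⟩
  constructor <;> linarith
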